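/- arXiv:1402.4965 — 2 statements merged into one kernel-verified Lean document; each statement's English description precedes it below -/
import Mathlib

section
/- There exists γ₀ > 0 such that for every γ with 0 < γ < γ₀ the following holds. Let α = 1/2, β = √3/2, and let C_γ ⊆ ℝ³ be the convex hull of the twelve points (1,0,1+γ), (α,β,1−γ), (−α,β,1+γ), (−1,0,1−γ), (−α,−β,1+γ), (α,−β,1−γ), (1,0,−1+γ), (α,β,−1−γ), (−α,β,−1+γ), (−1,0,−1−γ), (−α,−β,−1+γ), (α,−β,−1−γ). Let Λ be the lattice with basis a₁ = (1+α, β, 0), a₂ = (1+α, −β, 0), a₃ = (0,0,2). Then C_γ + Λ is a lattice covering of ℝ³, i.e., every point of ℝ³ lies in λ + C_γ for some λ ∈ Λ. -/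
open Pointwise

/-- `C + L` is a (lattice) covering of the whole space: every point lies in `l + C`
for some `l ∈ L`. -/
def IsLatticeCovering {ι : Type*} (C L : Set (ι → ℝ)) : Prop :=
  ∀ x : ι → ℝ, ∃ l ∈ L, x ∈ l +ᵥ C

/-- `C + L` is a tiling of the whole space: it is a covering and the interiors of
distinct translates are pairwise disjoint. -/
def IsLatticeTiling {ι : Type*} [Fintype ι] (C L : Set (ι → ℝ)) : Prop :=
  IsLatticeCovering C L ∧
    ∀ l ∈ L, ∀ m ∈ L, l ≠ m → Disjoint (interior (l +ᵥ C)) (interior (m +ᵥ C))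

/-- A convex body: a compact convex set with nonempty interior. -/
def IsConvexBody {ι : Type*} [Fintype ι] (C : Set (ι → ℝ)) : Prop :=
  Convex ℝ C ∧ IsCompact C ∧ (interior C).Nonempty

noncomputable section

/-- The twelve vertices of the polytope `C_γ`, with `α = 1/2`, `β = √3/2`. -/
def vertexSet (γ : ℝ) : Set (Fin 3 → ℝ) :=
  {![1, 0, 1 + γ], ![1/2, Real.sqrt 3 / 2, 1 - γ], ![-(1/2), Real.sqrt 3 / 2, 1 + γ],
   ![-1, 0, 1 - γ], ![-(1/2), -(Real.sqrt 3 / 2), 1 + γ], ![1/2, -(Real.sqrt 3 / 2), 1 - γ],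
   ![1, 0, -1 + γ], ![1/2, Real.sqrt 3 / 2, -1 - γ], ![-(1/2), Real.sqrt 3 / 2, -1 + γ],
   ![-1, 0, -1 - γ], ![-(1/2), -(Real.sqrt 3 / 2), -1 + γ], ![1/2, -(Real.sqrt 3 / 2), -1 - γ]}

/-- The polytope `C_γ`: the convex hull of the twelve vertices. -/
def Cbody (γ : ℝ) : Set (Fin 3 → ℝ) :=
  convexHull ℝ (vertexSet γ)

/-- The lattice `Λ` with basis `a₁ = (1+α, β, 0)`, `a₂ = (1+α, −β, 0)`, `a₃ = (0,0,2)`,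
where `α = 1/2`, `β = √3/2`. -/
def latticeΛ : Set (Fin 3 → ℝ) :=
  {x | ∃ c₁ c₂ c₃ : ℤ, x = c₁ • ![1 + 1/2, Real.sqrt 3 / 2, 0] +
    c₂ • ![1 + 1/2, -(Real.sqrt 3 / 2), 0] + c₃ • ![0, 0, 2]}

end

/-- A bilinear combination of four points of a convex set lies in the set. -/
theorem Convex.bilinear_comb_mem {E : Type*} [AddCommGroup E] [Module ℝ E] {C : Set E}
    (hC : Convex ℝ C) {a b c d : E} (ha : a ∈ C) (hb : b ∈ C) (hc : c ∈ C) (hd : d ∈ C)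
    {j k : ℝ} (hj : 0 ≤ j) (hj1 : j ≤ 1) (hk : 0 ≤ k) (hk1 : k ≤ 1) :
    j • (k • a + (1 - k) • b) + (1 - j) • (k • c + (1 - k) • d) ∈ C :=
  hC (hC ha hb hk (sub_nonneg.2 hk1) (by ring)) (hC hc hd hk (sub_nonneg.2 hk1) (by ring)) hj
    (sub_nonneg.2 hj1) (by ring)

/-- Over every point of the hexagon, `Cbody γ` contains the endpoints of a vertical segment of
length `2`. -/
theorem exists_vertical_segment (γ x t : ℝ) (ht : |t| ≤ 1 / 2) (hx : |x| + |t| ≤ 1) :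
    ∃ z : ℝ, ![x, Real.sqrt 3 * t, z] ∈ Cbody γ ∧ ![x, Real.sqrt 3 * t, z - 2] ∈ Cbody γ := by
  have hC : Convex ℝ (Cbody γ) := convex_convexHull ℝ _
  have hv : ∀ v ∈ vertexSet γ, v ∈ Cbody γ := fun v h => subset_convexHull ℝ _ h
  have hpos : 0 < 1 - |t| := by linarith
  obtain ⟨hx1, hx2⟩ := abs_le.1 (show |x| ≤ 1 - |t| by linarith)
  obtain ⟨k, hk, hk0, hk1⟩ : ∃ k : ℝ, x = (2 * k - 1) * (1 - |t|) ∧ 0 ≤ k ∧ k ≤ 1 := by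
    refine ⟨(x / (1 - |t|) + 1) / 2, by field_simp; ring, ?_, ?_⟩
    · have : -1 ≤ x / (1 - |t|) := by rw [le_div_iff₀ hpos]; linarith
      linarith
    · have : x / (1 - |t|) ≤ 1 := by rw [div_le_iff₀ hpos]; linarith
      linarith
  rcases le_total 0 t with h | h
  · rw [abs_of_nonneg h] at *
    refine ⟨2 * t * (k * (1 - γ) + (1 - k) * (1 + γ)) +
      (1 - 2 * t) * (k * (1 + γ) + (1 - k) * (1 - γ)), ?_, ?_⟩
    · convert hC.bilinear_comb_mem (hv ![1/2, Real.sqrt 3 / 2, 1 - γ] (by simp [vertexSet]))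
        (hv ![-(1/2), Real.sqrt 3 / 2, 1 + γ] (by simp [vertexSet]))
        (hv ![1, 0, 1 + γ] (by simp [vertexSet])) (hv ![-1, 0, 1 - γ] (by simp [vertexSet]))
        (j := 2 * t) (by linarith) (by linarith) hk0 hk1 using 1
      ext i; fin_cases i <;> simp [hk] <;> ring
    · convert hC.bilinear_comb_mem (hv ![1/2, Real.sqrt 3 / 2, -1 - γ] (by simp [vertexSet]))
        (hv ![-(1/2), Real.sqrt 3 / 2, -1 + γ] (by simp [vertexSet]))
        (hv ![1, 0, -1 + γ] (by simp [vertexSet])) (hv ![-1, 0, -1 - γ] (by simp [vertexSet]))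
        (j := 2 * t) (by linarith) (by linarith) hk0 hk1 using 1
      ext i; fin_cases i <;> simp [hk] <;> ring
  · rw [abs_of_nonpos h] at *
    refine ⟨2 * (-t) * (k * (1 - γ) + (1 - k) * (1 + γ)) +
      (1 - 2 * (-t)) * (k * (1 + γ) + (1 - k) * (1 - γ)), ?_, ?_⟩
    · convert hC.bilinear_comb_mem (hv ![1/2, -(Real.sqrt 3 / 2), 1 - γ] (by simp [vertexSet]))
        (hv ![-(1/2), -(Real.sqrt 3 / 2), 1 + γ] (by simp [vertexSet]))
        (hv ![1, 0, 1 + γ] (by simp [vertexSet])) (hv ![-1, 0, 1 - γ] (by simp [vertexSet]))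
        (j := 2 * (-t)) (by linarith) (by linarith) hk0 hk1 using 1
      ext i; fin_cases i <;> simp [hk] <;> ring
    · convert hC.bilinear_comb_mem (hv ![1/2, -(Real.sqrt 3 / 2), -1 - γ] (by simp [vertexSet]))
        (hv ![-(1/2), -(Real.sqrt 3 / 2), -1 + γ] (by simp [vertexSet]))
        (hv ![1, 0, -1 + γ] (by simp [vertexSet])) (hv ![-1, 0, -1 - γ] (by simp [vertexSet]))
        (j := 2 * (-t)) (by linarith) (by linarith) hk0 hk1 using 1
      ext i; fin_cases i <;> simp [hk] <;> ring

/-- The lattice translates of the regular hexagon cover the plane, in coordinates `(p, q)` with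
respect to the basis of the planar lattice. -/
theorem exists_int_sub_mem_hexagon (p q : ℝ) : ∃ m n : ℤ,
    |((p - m) - (q - n)) / 2| ≤ 1 / 2 ∧
      |3 / 2 * ((p - m) + (q - n))| + |((p - m) - (q - n)) / 2| ≤ 1 := by
  have key : ∀ p q : ℝ, 0 ≤ q → q ≤ p → p ≤ 1 → ∃ m n : ℤ,
      |((p - m) - (q - n)) / 2| ≤ 1 / 2 ∧
        |3 / 2 * ((p - m) + (q - n))| + |((p - m) - (q - n)) / 2| ≤ 1 := by
    intro p q hq hqp hp
    by_cases h0 : 2 * p + q ≤ 1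
    · refine ⟨0, 0, ?_⟩
      push_cast
      rw [abs_of_nonneg (by linarith : (0 : ℝ) ≤ 3 / 2 * ((p - 0) + (q - 0))),
        abs_of_nonneg (by linarith : (0 : ℝ) ≤ ((p - 0) - (q - 0)) / 2)]
      constructor <;> linarith
    by_cases h1 : 2 ≤ p + 2 * q
    · refine ⟨1, 1, ?_⟩
      push_cast
      rw [abs_of_nonpos (by linarith : 3 / 2 * ((p - 1) + (q - 1)) ≤ 0),
        abs_of_nonneg (by linarith : (0 : ℝ) ≤ ((p - 1) - (q - 1)) / 2)]
      constructor <;> linarith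
    · refine ⟨1, 0, ?_⟩
      push_cast
      rw [abs_of_nonpos (by linarith : ((p - 1) - (q - 0)) / 2 ≤ 0)]
      refine ⟨by linarith, ?_⟩
      rcases abs_cases (3 / 2 * ((p - 1) + (q - 0))) with h | h <;> linarith
  obtain ⟨m, n, h1, h2⟩ : ∃ m n : ℤ,
      |((Int.fract p - m) - (Int.fract q - n)) / 2| ≤ 1 / 2 ∧
        |3 / 2 * ((Int.fract p - m) + (Int.fract q - n))| +
          |((Int.fract p - m) - (Int.fract q - n)) / 2| ≤ 1 := by
    rcases le_total (Int.fract q) (Int.fract p) with h | h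
    · exact key _ _ (Int.fract_nonneg q) h (Int.fract_lt_one p).le
    · obtain ⟨m, n, h1, h2⟩ := key _ _ (Int.fract_nonneg p) h (Int.fract_lt_one q).le
      have e : |((Int.fract p - n) - (Int.fract q - m)) / 2| =
          |((Int.fract q - m) - (Int.fract p - n)) / 2| := by
        rw [← abs_neg]; congr 1; ring
      refine ⟨n, m, e ▸ h1, ?_⟩
      rw [e, add_comm (Int.fract p - n)]
      exact h2
  refine ⟨⌊p⌋ + m, ⌊q⌋ + n, ?_⟩
  push_cast
  rw [← sub_sub, ← sub_sub]
  exact ⟨h1, h2⟩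

/-- For all sufficiently small `γ > 0`, `C_γ + Λ` is a lattice covering of `ℝ³`. -/
theorem Cbody_lattice_covering :
    ∃ γ₀ > (0 : ℝ), ∀ γ : ℝ, 0 < γ → γ < γ₀ →
      IsLatticeCovering (Cbody γ) latticeΛ := by
  refine ⟨1, one_pos, fun γ _ _ v => ?_⟩
  have h3 : Real.sqrt 3 ≠ 0 := by positivity
  obtain ⟨m, n, h1, h2⟩ := exists_int_sub_mem_hexagon
    (v 0 / 3 + v 1 / Real.sqrt 3) (v 0 / 3 - v 1 / Real.sqrt 3)
  set p := v 0 / 3 + v 1 / Real.sqrt 3 with hp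
  set q := v 0 / 3 - v 1 / Real.sqrt 3 with hq
  obtain ⟨z, hz1, hz2⟩ := exists_vertical_segment γ _ _ h1 h2
  have hv0 : v 0 = 3 / 2 * (p + q) := by rw [hp, hq]; ring
  have hv1 : v 1 = Real.sqrt 3 * ((p - q) / 2) := by rw [hp, hq]; field_simp; ring
  have hl := Int.le_ceil ((v 2 - z) / 2)
  have hu := Int.ceil_lt_add_one ((v 2 - z) / 2)
  set c := ⌈(v 2 - z) / 2⌉
  refine ⟨_, ⟨m, n, c, rfl⟩, ?_⟩
  rw [Set.mem_vadd_set_iff_neg_vadd_mem]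
  convert (show Convex ℝ (Cbody γ) from convex_convexHull ℝ _) hz1 hz2
    (a := (v 2 - 2 * c - z + 2) / 2) (b := (z - (v 2 - 2 * c)) / 2)
    (by linarith) (by linarith) (by ring) using 1
  ext i
  fin_cases i <;> simp [hv0, hv1] <;> ring
end

section
/- There exists γ₀ > 0 such that for every γ with 0 < γ < γ₀ the following holds. Let α = 1/2, β = √3/2, let C_γ ⊆ ℝ³ be the convex hull of the twelve points (1,0,1+γ), (α,β,1−γ), (−α,β,1+γ), (−1,0,1−γ), (−α,−β,1+γ), (α,−β,1−γ), (1,0,−1+γ), (α,β,−1−γ), (−α,β,−1+γ), (−1,0,−1−γ), (−α,−β,−1+γ), (α,−β,−1−γ), and let Λ be the lattice with basis a₁ = (1+α, β, 0), a₂ = (1+α, −β, 0), a₃ = (0,0,2). Then C_γ is centrally symmetric, C_γ + Λ is a lattice covering of ℝ³, and there is no convex body P with P ⊆ C_γ such that P + Λ is a tiling of ℝ³. -/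
open Pointwise

theorem Cbody_halfSpace {γ a b c d : ℝ}
    (h : ∀ p ∈ vertexSet γ, a * p 0 + b * p 1 + c * p 2 ≤ d) :
    ∀ p ∈ Cbody γ, a * p 0 + b * p 1 + c * p 2 ≤ d := by
  have hconv : Convex ℝ {p : Fin 3 → ℝ | a * p 0 + b * p 1 + c * p 2 ≤ d} := by
    intro p hp q hq s t hs ht hst
    simp only [Set.mem_ofPred_eq, Pi.add_apply, Pi.smul_apply, smul_eq_mul] at *
    have h1 := mul_le_mul_of_nonneg_left hp hs
    have h2 := mul_le_mul_of_nonneg_left hq ht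
    have h3 : s * d + t * d = d := by rw [← add_mul, hst, one_mul]
    linarith
  exact fun p hp => convexHull_min h hconv hp

theorem convex_Cbody (γ : ℝ) : Convex ℝ (Cbody γ) :=
  convex_convexHull ℝ _

theorem forall_vertexSet {γ : ℝ} {Q : (Fin 3 → ℝ) → Prop} :
    (∀ p ∈ vertexSet γ, Q p) ↔
      Q ![1, 0, 1 + γ] ∧ Q ![1/2, √3 / 2, 1 - γ] ∧ Q ![-(1/2), √3 / 2, 1 + γ] ∧
      Q ![-1, 0, 1 - γ] ∧ Q ![-(1/2), -(√3 / 2), 1 + γ] ∧ Q ![1/2, -(√3 / 2), 1 - γ] ∧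
      Q ![1, 0, -1 + γ] ∧ Q ![1/2, √3 / 2, -1 - γ] ∧ Q ![-(1/2), √3 / 2, -1 + γ] ∧
      Q ![-1, 0, -1 - γ] ∧ Q ![-(1/2), -(√3 / 2), -1 + γ] ∧
      Q ![1/2, -(√3 / 2), -1 - γ] := by
  simp only [vertexSet, Set.forall_mem_insert, Set.mem_singleton_iff, forall_eq]

theorem Cbody_eq_neg (γ : ℝ) : Cbody γ = -Cbody γ := by
  have h : ∀ p ∈ vertexSet γ, -p ∈ vertexSet γ := by
    rw [forall_vertexSet]
    simp only [vertexSet, Matrix.neg_cons, Matrix.neg_empty, neg_neg, neg_zero, neg_add, neg_sub,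
      Set.mem_insert_iff, Set.mem_singleton_iff]
    have e1 : -1 + -γ = -1 - γ := by ring
    have e2 : γ - 1 = -1 + γ := by ring
    have e3 : 1 + -γ = 1 - γ := by ring
    have e4 : γ - -1 = 1 + γ := by ring
    simp [e1, e2, e3, e4]
  have h' : -vertexSet γ = vertexSet γ := by
    ext p
    exact ⟨fun hp => neg_neg p ▸ h _ hp, fun hp => h p hp⟩
  rw [Cbody, ← convexHull_neg, h']

/-- The vertical projection of `Cbody γ` lies in the regular hexagon. -/
theorem Cbody_hexagon {γ : ℝ} {p : Fin 3 → ℝ} (hp : p ∈ Cbody γ) :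
    |p 1| ≤ √3 / 2 ∧ |√3 * p 0 + p 1| ≤ √3 ∧ |√3 * p 0 - p 1| ≤ √3 := by
  have hr : 0 ≤ √3 := Real.sqrt_nonneg 3
  simp only [abs_le]
  refine ⟨⟨?_, ?_⟩, ⟨?_, ?_⟩, ⟨?_, ?_⟩⟩
  · have := Cbody_halfSpace (a := 0) (b := -1) (c := 0) (d := √3 / 2)
      (by rw [forall_vertexSet]; simp; linarith) p hp
    linarith
  · have := Cbody_halfSpace (a := 0) (b := 1) (c := 0) (d := √3 / 2)
      (by rw [forall_vertexSet]; simp; linarith) p hp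
    linarith
  · have := Cbody_halfSpace (a := -√3) (b := -1) (c := 0) (d := √3)
      (by rw [forall_vertexSet]; simp; constructorm* _ ∧ _ <;> linarith) p hp
    linarith
  · have := Cbody_halfSpace (a := √3) (b := 1) (c := 0) (d := √3)
      (by rw [forall_vertexSet]; simp; constructorm* _ ∧ _ <;> linarith) p hp
    linarith
  · have := Cbody_halfSpace (a := -√3) (b := 1) (c := 0) (d := √3)
      (by rw [forall_vertexSet]; simp; constructorm* _ ∧ _ <;> linarith) p hp
    linarith
  · have := Cbody_halfSpace (a := √3) (b := -1) (c := 0) (d := √3)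
      (by rw [forall_vertexSet]; simp; constructorm* _ ∧ _ <;> linarith) p hp
    linarith

theorem int_abs_lt_two_of_strip {r u : ℝ} (hr : 0 < r) {n : ℤ} (h : |u| < r)
    (h' : |u - r * n| ≤ r) : |n| < 2 := by
  rw [abs_lt] at h
  rw [abs_le] at h'
  have h1 : (n : ℝ) < 2 := by
    by_contra! hn
    nlinarith
  have h2 : (-2 : ℝ) < n := by
    by_contra! hn
    nlinarith
  rw [abs_lt]
  exact ⟨by exact_mod_cast h2, by exact_mod_cast h1⟩

/-- If `P ⊆ Cbody γ` covers space, then over interior points of the hexagon already the vertical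
translates of `P` cover. -/
theorem exists_vertical_translate_mem {γ : ℝ} {P : Set (Fin 3 → ℝ)} (hP : P ⊆ Cbody γ)
    (hcov : IsLatticeCovering P latticeΛ) {x y : ℝ} (h₁ : |y| < √3 / 2)
    (h₂ : |√3 * x + y| < √3) (h₃ : |√3 * x - y| < √3) (z : ℝ) :
    ∃ k : ℤ, ![x, y, z - 2 * k] ∈ P := by
  have hr : 0 < √3 := Real.sqrt_pos.2 (by norm_num)
  obtain ⟨l, ⟨m, n, k, rfl⟩, hl⟩ := hcov ![x, y, z]
  rw [Set.mem_vadd_set_iff_neg_vadd_mem] at hl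
  obtain ⟨g₁, g₂, g₃⟩ := Cbody_hexagon (hP hl)
  simp at g₁ g₂ g₃
  have e₁ : |m - n| < 2 := by
    refine int_abs_lt_two_of_strip (half_pos hr) h₁ (le_of_eq_of_le ?_ g₁)
    congr 1; push_cast; ring
  have e₂ : |2 * m + n| < 2 := by
    refine int_abs_lt_two_of_strip hr h₂ (le_of_eq_of_le ?_ g₂)
    congr 1; push_cast; ring
  have e₃ : |m + 2 * n| < 2 := by
    refine int_abs_lt_two_of_strip hr h₃ (le_of_eq_of_le ?_ g₃)
    congr 1; push_cast; ring
  rw [abs_lt] at e₁ e₂ e₃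
  obtain rfl : m = 0 := by omega
  obtain rfl : n = 0 := by omega
  refine ⟨k, ?_⟩
  convert hl using 1
  ext i
  fin_cases i <;> simp
  ring

/-- If `P ⊆ Cbody γ` is closed and covers space, then `P` contains the open vertical edges of
`Cbody γ`. The last hypothesis says that the vertical edge over `(a, b)` is exposed. -/
theorem vertical_edge_subset {γ : ℝ} {P : Set (Fin 3 → ℝ)} (hP : P ⊆ Cbody γ)
    (hclosed : IsClosed P) (hcov : IsLatticeCovering P latticeΛ) {a b c : ℝ}
    (hab : a * a + b * b = 1)
    (h₁ : |b| ≤ √3 / 2) (h₂ : |√3 * a + b| ≤ √3) (h₃ : |√3 * a - b| ≤ √3)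
    (hedge : ∀ p ∈ vertexSet γ, 4 * γ * (a * p 0 + b * p 1) + 1 * p 2 ≤ 1 + c + 4 * γ ∧
      4 * γ * (a * p 0 + b * p 1) + (-1) * p 2 ≤ 1 - c + 4 * γ) {w : ℝ} (hw : |w - c| < 1) :
    ![a, b, w] ∈ P := by
  have hr : 0 < √3 := Real.sqrt_pos.2 (by norm_num)
  rw [abs_lt] at hw
  have hlim : Filter.Tendsto (fun t : ℝ => ![t * a, t * b, w]) (nhdsWithin 1 (Set.Iio 1))
      (nhds ![a, b, w]) := by
    have hcont : Continuous fun t : ℝ => ![t * a, t * b, w] := by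
      refine continuous_pi fun i => ?_
      fin_cases i <;> simp <;> fun_prop
    simpa using (hcont.tendsto 1).mono_left nhdsWithin_le_nhds
  refine hclosed.mem_of_tendsto hlim ?_
  have hnear : ∀ᶠ t : ℝ in nhdsWithin 1 (Set.Iio 1),
      4 * γ * (1 - t) < 1 - (w - c) ∧ 4 * γ * (1 - t) < 1 + (w - c) ∧ 0 < t := by
    apply Filter.Eventually.filter_mono nhdsWithin_le_nhds
    refine Filter.Eventually.and ?_ (Filter.Eventually.and ?_ ?_)
    · exact ContinuousAt.eventually_lt (by fun_prop) (by fun_prop) (by simp; linarith)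
    · exact ContinuousAt.eventually_lt (by fun_prop) (by fun_prop) (by simp; linarith)
    · exact lt_mem_nhds one_pos
  filter_upwards [hnear, self_mem_nhdsWithin] with t ⟨ht₁, ht₂, ht₀⟩ ht
  have key : ∀ {u r : ℝ}, 0 < r → |u| ≤ r → |t * u| < r := by
    intro u r hr hu
    rw [abs_mul, abs_of_pos ht₀]
    have : t < 1 := ht
    nlinarith [abs_nonneg u]
  obtain ⟨k, hk⟩ := exists_vertical_translate_mem hP hcov (x := t * a) (y := t * b)
    (key (half_pos hr) h₁) (by have := key hr h₂; rwa [mul_add, mul_left_comm] at this)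
    (by have := key hr h₃; rwa [mul_sub, mul_left_comm] at this) w
  have u₁ := Cbody_halfSpace (a := 4 * γ * a) (b := 4 * γ * b) (c := 1) (d := 1 + c + 4 * γ)
    (fun p hp => by linarith [(hedge p hp).1]) _ (hP hk)
  have u₂ := Cbody_halfSpace (a := 4 * γ * a) (b := 4 * γ * b) (c := -1) (d := 1 - c + 4 * γ)
    (fun p hp => by linarith [(hedge p hp).2]) _ (hP hk)
  have hab' : 4 * γ * a * (t * a) + 4 * γ * b * (t * b) = 4 * γ * t := by
    linear_combination 4 * γ * t * hab
  simp at u₁ u₂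
  have k₁ : (k : ℝ) < 1 := by linarith
  have k₂ : (-1 : ℝ) < k := by linarith
  have k₁' : k < 1 := by exact_mod_cast k₁
  have k₂' : -1 < k := by exact_mod_cast k₂
  obtain rfl : k = 0 := by omega
  simpa using hk

theorem axis_mem_of_three_mem {P : Set (Fin 3 → ℝ)} (hconv : Convex ℝ P)
    {x₁ y₁ x₂ y₂ x₃ y₃ w : ℝ}
    (h₁ : ![x₁, y₁, w] ∈ P) (h₂ : ![x₂, y₂, w] ∈ P) (h₃ : ![x₃, y₃, w] ∈ P)
    (hx : x₁ + x₂ + x₃ = 0) (hy : y₁ + y₂ + y₃ = 0) : ![0, 0, w] ∈ P := by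
  have h := hconv (hconv h₁ h₂ (a := 1/2) (b := 1/2) (by norm_num) (by norm_num) (by norm_num)) h₃
    (a := 2/3) (b := 1/3) (by norm_num) (by norm_num) (by norm_num)
  convert h using 1
  ext i
  fin_cases i <;> simp <;> linarith

theorem not_tiling_of_subset_Cbody {γ : ℝ} (hγ : 0 < γ) (hγ' : γ < 1) {P : Set (Fin 3 → ℝ)}
    (hbody : IsConvexBody P) (hP : P ⊆ Cbody γ) : ¬ IsLatticeTiling P latticeΛ := by
  rintro ⟨hcov, hdisj⟩
  obtain ⟨hconv, hcomp, c, hc⟩ := hbody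
  have hr : 0 < √3 := Real.sqrt_pos.2 (by norm_num)
  have hsq : √3 * √3 = 3 := Real.mul_self_sqrt (by norm_num)
  have hsq' : γ * (√3 * √3) = γ * 3 := by rw [hsq]
  have edge := fun {a b c : ℝ} hab h₁ h₂ h₃ hedge {w : ℝ} hw =>
    vertical_edge_subset (a := a) (b := b) (c := c) (w := w) hP hcomp.isClosed hcov
      hab h₁ h₂ h₃ hedge hw
  have htop : |(1 + γ / 2) - γ| < 1 := by rw [abs_lt]; constructor <;> linarith
  have hbot : |-(1 + γ / 2) - -γ| < 1 := by rw [abs_lt]; constructor <;> linarith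
  have top : ![0, 0, 1 + γ / 2] ∈ P := by
    refine axis_mem_of_three_mem hconv (x₁ := 1) (y₁ := 0) (x₂ := -(1/2)) (y₂ := √3 / 2)
      (x₃ := -(1/2)) (y₃ := -(√3 / 2)) (edge ?_ ?_ ?_ ?_ ?_ htop) (edge ?_ ?_ ?_ ?_ ?_ htop)
      (edge ?_ ?_ ?_ ?_ ?_ htop) (by norm_num) (by norm_num)
    all_goals try rw [forall_vertexSet]
    all_goals try simp only [Matrix.cons_val, abs_le]
    all_goals
      (try constructorm* _ ∧ _) <;> linarith
  have bot : ![0, 0, -(1 + γ / 2)] ∈ P := by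
    refine axis_mem_of_three_mem hconv (x₁ := -1) (y₁ := 0) (x₂ := 1/2) (y₂ := √3 / 2)
      (x₃ := 1/2) (y₃ := -(√3 / 2)) (edge ?_ ?_ ?_ ?_ ?_ hbot) (edge ?_ ?_ ?_ ?_ ?_ hbot)
      (edge ?_ ?_ ?_ ?_ ?_ hbot) (by norm_num) (by norm_num)
    all_goals try rw [forall_vertexSet]
    all_goals try simp only [Matrix.cons_val, abs_le]
    all_goals
      (try constructorm* _ ∧ _) <;> linarith
  obtain ⟨s, hs⟩ : ∃ s : ℝ, ![0, 0, s] ∈ interior P := by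
    obtain ⟨g₁, g₂, g₃⟩ := Cbody_hexagon (hP (interior_subset hc))
    have key : ∀ {u v r : ℝ}, 0 < r → |u| ≤ r → v = -(1/2) * u → |v| < r := by
      rintro u v r hr hu rfl
      rw [abs_mul]
      norm_num
      linarith
    obtain ⟨k, hk⟩ := exists_vertical_translate_mem hP hcov (x := -(1/2) * c 0)
      (y := -(1/2) * c 1) (key (half_pos hr) g₁ rfl) (key hr g₂ (by ring))
      (key hr g₃ (by ring)) 0
    have := hconv.combo_interior_self_mem_interior hc hk (a := 1/3) (b := 2/3) (by norm_num)
      (by norm_num) (by norm_num)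
    refine ⟨1/3 * c 2 + 2/3 * (0 - 2 * k), ?_⟩
    convert this using 1
    ext i
    fin_cases i <;> simp <;> ring
  set h := 1 + γ / 2 with hh
  have h1 : 1 < h := by linarith
  have hinv : h⁻¹ < 1 := inv_lt_one_of_one_lt₀ h1
  have hh' : h⁻¹ * h = 1 := inv_mul_cancel₀ (by positivity)
  have up : ![0, 0, (1 - h⁻¹) * s + 1] ∈ interior P := by
    have := hconv.combo_interior_self_mem_interior hs top (a := 1 - h⁻¹) (b := h⁻¹) (by linarith)
      (by positivity) (by ring)
    convert this using 1
    ext i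
    fin_cases i <;> simp [hh']
  have down : ![0, 0, (1 - h⁻¹) * s - 1] ∈ interior P := by
    have := hconv.combo_interior_self_mem_interior hs bot (a := 1 - h⁻¹) (b := h⁻¹) (by linarith)
      (by positivity) (by ring)
    convert this using 1
    ext i
    fin_cases i <;> simp [hh']
    ring
  have hne : (0 : Fin 3 → ℝ) ≠ ![0, 0, 2] := fun h => by simpa using congrFun h 2
  refine Set.disjoint_left.1 (hdisj 0 ⟨0, 0, 0, by simp⟩ ![0, 0, 2] ⟨0, 0, 1, by simp⟩ hne)
    (show ![0, 0, (1 - h⁻¹) * s + 1] ∈ _ by simpa using up) ?_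
  rw [interior_vadd, Set.mem_vadd_set_iff_neg_vadd_mem]
  convert down using 1
  ext i
  fin_cases i <;> simp
  ring

/-- The set of coordinates, with respect to `(1, 0)` and `(1/2, √3/2)`, of the points of the plane
over which `Cbody γ` contains a vertical segment of length two. -/
def longFibers (γ : ℝ) : Set (ℝ × ℝ) :=
  {q | ∃ z : ℝ, ![q.1 + q.2 / 2, √3 / 2 * q.2, z - 1] ∈ Cbody γ ∧
    ![q.1 + q.2 / 2, √3 / 2 * q.2, z + 1] ∈ Cbody γ}

theorem convex_longFibers (γ : ℝ) : Convex ℝ (longFibers γ) := by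
  rintro ⟨x, y⟩ ⟨z, h₁, h₂⟩ ⟨x', y'⟩ ⟨z', h₁', h₂'⟩ a b ha hb hab
  refine ⟨a * z + b * z', ?_, ?_⟩
  · convert convex_Cbody γ h₁ h₁' ha hb hab using 1
    ext i
    fin_cases i <;> simp
    · ring
    · ring
    · linear_combination hab
  · convert convex_Cbody γ h₂ h₂' ha hb hab using 1
    ext i
    fin_cases i <;> simp
    · ring
    · ring
    · linear_combination (-hab)

theorem hexagon_vertices_mem_longFibers (γ : ℝ) :
    (1, 0) ∈ longFibers γ ∧ (0, 1) ∈ longFibers γ ∧ (-1, 1) ∈ longFibers γ ∧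
      (-1, 0) ∈ longFibers γ ∧ (0, -1) ∈ longFibers γ ∧ (1, -1) ∈ longFibers γ := by
  have h := (forall_vertexSet (Q := (· ∈ Cbody γ))).1 fun p hp => subset_convexHull ℝ (vertexSet γ) hp
  obtain ⟨t₁, t₂, t₃, t₄, t₅, t₆, b₁, b₂, b₃, b₄, b₅, b₆⟩ := h
  refine ⟨⟨γ, ?_, ?_⟩, ⟨-γ, ?_, ?_⟩, ⟨γ, ?_, ?_⟩, ⟨-γ, ?_, ?_⟩, ⟨γ, ?_, ?_⟩, ⟨-γ, ?_, ?_⟩⟩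
  · convert b₁ using 1
    ext i
    fin_cases i <;> simp <;> ring
  · convert t₁ using 1
    ext i
    fin_cases i <;> simp <;> ring
  · convert b₂ using 1
    ext i
    fin_cases i <;> simp <;> ring
  · convert t₂ using 1
    ext i
    fin_cases i <;> simp <;> ring
  · convert b₃ using 1
    ext i
    fin_cases i <;> simp <;> ring
  · convert t₃ using 1
    ext i
    fin_cases i <;> simp <;> ring
  · convert b₄ using 1
    ext i
    fin_cases i <;> simp <;> ring
  · convert t₄ using 1
    ext i
    fin_cases i <;> simp <;> ring
  · convert b₅ using 1
    ext i
    fin_cases i <;> simp <;> ring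
  · convert t₅ using 1
    ext i
    fin_cases i <;> simp <;> ring
  · convert b₆ using 1
    ext i
    fin_cases i <;> simp <;> ring
  · convert t₆ using 1
    ext i
    fin_cases i <;> simp <;> ring

/-- Every point of the plane is congruent, modulo the projected lattice, to a point of
`longFibers γ`. -/
theorem exists_translate_mem_longFibers (γ s t : ℝ) :
    ∃ m n : ℤ, (s - (m + 2 * n), t - (m - n)) ∈ longFibers γ := by
  obtain ⟨v₁, v₂, v₃, v₄, v₅, v₆⟩ := hexagon_vertices_mem_longFibers γ
  have hconv := convex_longFibers γ
  have v₀ : (0, 0) ∈ longFibers γ := by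
    convert hconv v₁ v₄ (a := 1/2) (b := 1/2) (by norm_num) (by norm_num) (by norm_num) using 1
    ext <;> simp
  have tri : ∀ {p q : ℝ × ℝ}, p ∈ longFibers γ → q ∈ longFibers γ → ∀ a b : ℝ, 0 ≤ a → 0 ≤ b →
      a + b ≤ 1 → a • p + b • q ∈ longFibers γ := by
    intro p q hp hq a b ha hb hab
    have h := hconv.sum_mem (t := Finset.univ) (w := ![a, b, 1 - a - b]) (z := ![p, q, (0, 0)])
      (by intro i _; fin_cases i <;> simp <;> linarith) (by simp [Fin.sum_univ_three])
      (by intro i _; fin_cases i <;> simpa)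
    simp only [Fin.sum_univ_three, Matrix.cons_val, Prod.mk_zero_zero, smul_zero, add_zero] at h
    exact h
  obtain ⟨i, σ, rfl, hσ, hσ'⟩ : ∃ (i : ℤ) (σ : ℝ), s = i + σ ∧ 0 ≤ σ ∧ σ ≤ 1 :=
    ⟨⌊s⌋, Int.fract s, (Int.floor_add_fract s).symm, Int.fract_nonneg s, (Int.fract_lt_one s).le⟩
  obtain ⟨j, τ, rfl, hτ, hτ'⟩ : ∃ (j : ℤ) (τ : ℝ), t = j + τ ∧ 0 ≤ τ ∧ τ ≤ 1 :=
    ⟨⌊t⌋, Int.fract t, (Int.floor_add_fract t).symm, Int.fract_nonneg t, (Int.fract_lt_one t).le⟩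
  obtain ⟨k, hk⟩ : ∃ k : ℤ, i = j + 3 * k ∨ i = j + 1 + 3 * k ∨ i = j - 1 + 3 * k :=
    ⟨(i - j + 1) / 3, by omega⟩
  rcases hk with rfl | rfl | rfl <;> rcases le_total (σ + τ) 1 with hle | hle
  · refine ⟨j + k, k, ?_⟩
    convert tri v₁ v₂ σ τ (by linarith) (by linarith) (by linarith) using 1
    ext <;> simp <;> ring
  · refine ⟨j + 1 + k, k, ?_⟩
    convert tri v₄ v₅ (1 - σ) (1 - τ) (by linarith) (by linarith) (by linarith) using 1
    ext <;> simp <;> ring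
  · refine ⟨j + 1 + k, k, ?_⟩
    convert tri v₅ v₆ (1 - σ - τ) σ (by linarith) (by linarith) (by linarith) using 1
    ext <;> simp <;> ring
  · refine ⟨j + 1 + k, k, ?_⟩
    convert tri v₆ v₁ (1 - τ) (σ + τ - 1) (by linarith) (by linarith) (by linarith) using 1
    ext <;> simp <;> ring
  · refine ⟨j + k, k, ?_⟩
    convert tri v₄ v₃ (1 - σ - τ) τ (by linarith) (by linarith) (by linarith) using 1
    ext <;> simp <;> ring
  · refine ⟨j + k, k, ?_⟩
    convert tri v₃ v₂ (1 - σ) (σ + τ - 1) (by linarith) (by linarith) (by linarith) using 1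
    ext <;> simp <;> ring

theorem Cbody_covering (γ : ℝ) : IsLatticeCovering (Cbody γ) latticeΛ := by
  intro x
  have hr : √3 ≠ 0 := (Real.sqrt_pos.2 (by norm_num)).ne'
  obtain ⟨m, n, z, hlo, hhi⟩ :=
    exists_translate_mem_longFibers γ (x 0 - x 1 / √3) (2 * x 1 / √3)
  set k := ⌊(x 2 - z + 1) / 2⌋ with hk
  have hk₁ : (k : ℝ) ≤ (x 2 - z + 1) / 2 := Int.floor_le _
  have hk₂ : (x 2 - z + 1) / 2 < k + 1 := Int.lt_floor_add_one _
  refine ⟨_, ⟨m, n, k, rfl⟩, ?_⟩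
  rw [Set.mem_vadd_set_iff_neg_vadd_mem]
  set θ := (x 2 - 2 * k - z + 1) / 2 with hθ
  have h := convex_Cbody γ hlo hhi (a := 1 - θ) (b := θ) (by linarith) (by linarith)
    (by ring)
  convert h using 1
  ext i
  fin_cases i <;> simp
  · field_simp
    ring
  · field_simp
    ring
  · linarith

/-- For all sufficiently small `γ > 0`: `C_γ` is centrally symmetric, `C_γ + Λ` is a
lattice covering of `ℝ³`, and there is no convex body `P ⊆ C_γ` such that `P + Λ`
is a tiling of `ℝ³`. -/
theorem Cbody_counterexample :
    ∃ γ₀ > (0 : ℝ), ∀ γ : ℝ, 0 < γ → γ < γ₀ →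
      Cbody γ = -(Cbody γ) ∧
      IsLatticeCovering (Cbody γ) latticeΛ ∧
      ¬ ∃ P : Set (Fin 3 → ℝ), IsConvexBody P ∧ P ⊆ Cbody γ ∧
          IsLatticeTiling P latticeΛ := by
  refine ⟨1, one_pos, fun γ hγ hγ' => ⟨Cbody_eq_neg γ, Cbody_covering γ, ?_⟩⟩
  rintro ⟨P, hbody, hP, htile⟩
  exact not_tiling_of_subset_Cbody hγ hγ' hbody hP htile
end
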